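/- arXiv:2012.12737 — 3 statements merged into one kernel-verified Lean document; each statement's English description precedes it below -/
import Mathlib

section
/- Let Ω ⊆ ℝ^n be a nonempty closed convex set, x̄ ∈ Ω with Ω \ {x̄} nonempty, and g ∈ ℝ^n. Then sup_{h ∈ Ω, h ≠ x̄} ⟨g, (h − x̄)/‖h − x̄‖⟩ = sup_{h ∈ T_Ω(x̄), h ≠ 0} ⟨g, h/‖h‖⟩. -/
open Set Metric RealInnerProductSpace

noncomputable section

/-- The tangent cone to a convex set `Ω` at `x`: the closure of the cone of feasible
directions. -/
def tangentCone {n : ℕ} (Ω : Set (EuclideanSpace ℝ (Fin n))) (x : EuclideanSpace ℝ (Fin n)) :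
    Set (EuclideanSpace ℝ (Fin n)) :=
  closure {w | ∃ l : ℝ, 0 < l ∧ x + l • w ∈ Ω}

/-- The normal cone to a convex set `Ω` at `x`. -/
def normalCone {n : ℕ} (Ω : Set (EuclideanSpace ℝ (Fin n))) (x : EuclideanSpace ℝ (Fin n)) :
    Set (EuclideanSpace ℝ (Fin n)) :=
  {v | ∀ y ∈ Ω, ⟪v, y - x⟫ ≤ 0}

/-- `p` is the Euclidean (metric) projection of `g` onto the set `C`. -/
def IsProjection {n : ℕ} (C : Set (EuclideanSpace ℝ (Fin n)))
    (g p : EuclideanSpace ℝ (Fin n)) : Prop :=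
  p ∈ C ∧ ∀ w ∈ C, ‖g - p‖ ≤ ‖g - w‖

lemma inner_normalize_le_norm {E : Type*} [NormedAddCommGroup E] [InnerProductSpace ℝ E]
    (g w : E) : ⟪g, ‖w‖⁻¹ • w⟫ ≤ ‖g‖ := by
  rw [real_inner_smul_right]
  rcases eq_or_ne w 0 with rfl | hw
  · simp
  · rw [inv_mul_le_iff₀ (norm_pos_iff.2 hw), mul_comm]
    exact real_inner_le_norm g w

lemma sub_mem_tangentCone {n : ℕ} {Ω : Set (EuclideanSpace ℝ (Fin n))}
    {x y : EuclideanSpace ℝ (Fin n)} (hy : y ∈ Ω) : y - x ∈ tangentCone Ω x :=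
  subset_closure ⟨1, one_pos, by simpa using hy⟩

/-- A bound on the normalized slopes over the set passes to its tangent cone. -/
lemma inner_le_mul_norm_of_mem_tangentCone {n : ℕ} {Ω : Set (EuclideanSpace ℝ (Fin n))}
    {x g w : EuclideanSpace ℝ (Fin n)} {c : ℝ}
    (hc : ∀ y ∈ Ω, y ≠ x → ⟪g, ‖y - x‖⁻¹ • (y - x)⟫ ≤ c) (hw : w ∈ tangentCone Ω x) :
    ⟪g, w⟫ ≤ c * ‖w‖ := by
  have hcl : IsClosed {w : EuclideanSpace ℝ (Fin n) | ⟪g, w⟫ ≤ c * ‖w‖} :=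
    isClosed_le (by fun_prop) (by fun_prop)
  refine closure_minimal ?_ hcl hw
  rintro v ⟨l, hl, hv⟩
  rcases eq_or_ne v 0 with rfl | hv0
  · simp
  have h := hc _ hv (by simp [hl.ne', hv0])
  have hn : 0 < ‖l • v‖ := norm_pos_iff.2 (smul_ne_zero hl.ne' hv0)
  rw [add_sub_cancel_left, real_inner_smul_right, inv_mul_le_iff₀ hn, real_inner_smul_right,
    norm_smul, Real.norm_of_nonneg hl.le] at h
  exact le_of_mul_le_mul_left (by linarith) hl

/-- equation (23) in the paper: the sup of the normalized slopes over the
punctured feasible set equals the sup of the normalized slopes over the punctured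
tangent cone. -/
theorem stmt2 {n : ℕ} (Ω : Set (EuclideanSpace ℝ (Fin n)))
    (hΩne : Ω.Nonempty) (hΩcl : IsClosed Ω) (hΩconv : Convex ℝ Ω)
    (xbar : EuclideanSpace ℝ (Fin n)) (hxbar : xbar ∈ Ω)
    (hne : (Ω \ {xbar}).Nonempty)
    (g : EuclideanSpace ℝ (Fin n)) :
    sSup {r : ℝ | ∃ h ∈ Ω, h ≠ xbar ∧ r = ⟪g, ‖h - xbar‖⁻¹ • (h - xbar)⟫} =
      sSup {r : ℝ | ∃ h ∈ tangentCone Ω xbar, h ≠ 0 ∧ r = ⟪g, ‖h‖⁻¹ • h⟫} := by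
  obtain ⟨y, hy, hyx⟩ := hne
  have hyx : y ≠ xbar := hyx
  apply le_antisymm
  · refine csSup_le_csSup ⟨‖g‖, ?_⟩ ⟨_, y, hy, hyx, rfl⟩ ?_
    · rintro _ ⟨h, -, -, rfl⟩
      exact inner_normalize_le_norm g h
    · rintro _ ⟨h, hh, hhx, rfl⟩
      exact ⟨h - xbar, sub_mem_tangentCone hh, sub_ne_zero.2 hhx, rfl⟩
  · refine csSup_le ⟨_, y - xbar, sub_mem_tangentCone hy, sub_ne_zero.2 hyx, rfl⟩ ?_
    rintro _ ⟨h, hh, hh0, rfl⟩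
    rw [real_inner_smul_right, inv_mul_le_iff₀ (norm_pos_iff.2 hh0), mul_comm]
    refine inner_le_mul_norm_of_mem_tangentCone (fun z hz hzx => ?_) hh
    refine le_csSup ⟨‖g‖, ?_⟩ ⟨z, hz, hzx, rfl⟩
    rintro _ ⟨h, -, -, rfl⟩
    exact inner_normalize_le_norm g _
end
end

section
/- Let Ω ⊆ ℝ^n be a compact convex set with diameter D > 0, let x ∈ Ω and g ∈ ℝ^n be such that ‖π(T_Ω(x), g)‖ > 0. Let PW > 0 and let d ∈ ℝ^n with 0 < ‖d‖ ≤ D satisfy the pyramidal-width slope bound ⟨g, d⟩ ≥ PW · ⟨g, e/‖e‖⟩ for every e ∈ (Ω − x) \ {0} with ⟨g, e⟩ > 0. Then ⟨g, d⟩ / (‖π(T_Ω(x), g)‖ · ‖d‖) ≥ PW / D. (In particular, a pairwise Frank-Wolfe direction d = s − q, with s a maximizer of ⟨g, ·⟩ over Ω and q a minimizer of ⟨g, ·⟩ over an active set for x, satisfies this slope bound with PW equal to the pyramidal width of the atom set, so its normalized slope is at least PWidth(A)/D.) -/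
open Set Metric RealInnerProductSpace

noncomputable section

/-- The tangent cone is stable under multiplication by positive scalars. -/
theorem smul_mem_tangentCone {n : ℕ} {Ω : Set (EuclideanSpace ℝ (Fin n))}
    {x w : EuclideanSpace ℝ (Fin n)} (hw : w ∈ tangentCone Ω x) {c : ℝ} (hc : 0 < c) :
    c • w ∈ tangentCone Ω x := by
  refine map_mem_closure (continuous_const_smul c) hw ?_
  rintro v ⟨l, hl, hv⟩
  refine ⟨l / c, div_pos hl hc, ?_⟩
  rwa [smul_smul, div_mul_cancel₀ _ hc.ne']

/-- The projection `p` of `g` onto a tangent cone satisfies `‖p‖ ^ 2 ≤ ⟪g, p⟫`. -/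
theorem IsProjection.norm_sq_le_inner {n : ℕ} {Ω : Set (EuclideanSpace ℝ (Fin n))}
    {x g p : EuclideanSpace ℝ (Fin n)} (hp : IsProjection (tangentCone Ω x) g p) :
    ‖p‖ ^ 2 ≤ ⟪g, p⟫ := by
  have key : ∀ u : ℝ, 0 < u → u < 1 → ‖p‖ ^ 2 ≤ ⟪g, p⟫ + u * ‖p‖ ^ 2 := by
    intro u hu0 hu1
    have h := hp.2 _ (smul_mem_tangentCone hp.1 (sub_pos.2 hu1))
    have h2 := pow_le_pow_left₀ (norm_nonneg _) h 2
    rw [norm_sub_sq_real, norm_sub_sq_real, inner_smul_right, norm_smul, mul_pow,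
      Real.norm_eq_abs, sq_abs] at h2
    have h3 : 0 ≤ u * (2 * ⟪g, p⟫ + u * ‖p‖ ^ 2 - 2 * ‖p‖ ^ 2) := by nlinarith
    have h4 : 0 ≤ 2 * ⟪g, p⟫ + u * ‖p‖ ^ 2 - 2 * ‖p‖ ^ 2 := nonneg_of_mul_nonneg_right h3 hu0
    nlinarith [mul_nonneg hu0.le (sq_nonneg ‖p‖)]
  have hlim : Filter.Tendsto (fun u : ℝ => ⟪g, p⟫ + u * ‖p‖ ^ 2) (nhdsWithin 0 (Ioi 0))
      (nhds ⟪g, p⟫) := by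
    have hc : Continuous fun u : ℝ => ⟪g, p⟫ + u * ‖p‖ ^ 2 := by fun_prop
    simpa using (hc.tendsto 0).mono_left nhdsWithin_le_nhds
  refine ge_of_tendsto hlim ?_
  filter_upwards [Ioo_mem_nhdsGT (zero_lt_one (α := ℝ))] with u hu
  exact key u hu.1 hu.2

/-- under the pyramidal-width slope bound, the normalized slope of the
selected direction `d` (e.g. a pairwise Frank-Wolfe direction) is at least `PW / D`. -/
theorem stmt3 {n : ℕ} (Ω : Set (EuclideanSpace ℝ (Fin n)))
    (hΩcp : IsCompact Ω) (hΩconv : Convex ℝ Ω)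
    (D : ℝ) (hD : D = Metric.diam Ω) (hDpos : 0 < D)
    (x : EuclideanSpace ℝ (Fin n)) (hx : x ∈ Ω)
    (g p : EuclideanSpace ℝ (Fin n))
    (hp : IsProjection (tangentCone Ω x) g p) (hppos : 0 < ‖p‖)
    (PW : ℝ) (hPW : 0 < PW)
    (d : EuclideanSpace ℝ (Fin n)) (hd0 : 0 < ‖d‖) (hdD : ‖d‖ ≤ D)
    (hslope : ∀ e : EuclideanSpace ℝ (Fin n), (∃ h ∈ Ω, e = h - x) → e ≠ 0 →
      0 < ⟪g, e⟫ → PW * ⟪g, ‖e‖⁻¹ • e⟫ ≤ ⟪g, d⟫) :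
    PW / D ≤ ⟪g, d⟫ / (‖p‖ * ‖d‖) := by
  have hsq := hp.norm_sq_le_inner
  have hgp : 0 < ⟪g, p⟫ := lt_of_lt_of_le (by positivity) hsq
  have hopen : IsOpen {w : EuclideanSpace ℝ (Fin n) | 0 < ⟪g, w⟫} :=
    isOpen_lt continuous_const (by fun_prop)
  have hclosed : IsClosed {w : EuclideanSpace ℝ (Fin n) | PW * ⟪g, w⟫ ≤ ⟪g, d⟫ * ‖w‖} :=
    isClosed_le (by fun_prop) (by fun_prop)
  have hmem : PW * ⟪g, p⟫ ≤ ⟪g, d⟫ * ‖p‖ := by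
    refine closure_minimal ?_ hclosed (hopen.inter_closure ⟨hgp, hp.1⟩)
    rintro w ⟨hw, l, hl, hlw⟩
    have hw' : 0 < ⟪g, w⟫ := hw
    have hw0 : w ≠ 0 := by
      rintro rfl
      simp at hw'
    have hwn : 0 < ‖w‖ := norm_pos_iff.2 hw0
    have h := hslope (l • w) ⟨_, hlw, by simp⟩ (smul_ne_zero hl.ne' hw0)
      (by rw [inner_smul_right]; positivity)
    rw [norm_smul, Real.norm_of_nonneg hl.le, inner_smul_right, inner_smul_right] at h
    have heq : PW * ((l * ‖w‖)⁻¹ * (l * ⟪g, w⟫)) = PW * ⟪g, w⟫ / ‖w‖ := by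
      field_simp
    rw [heq, div_le_iff₀ hwn] at h
    exact h
  have hle : PW * ‖p‖ ≤ ⟪g, d⟫ := by
    refine le_of_mul_le_mul_right ?_ hppos
    nlinarith [mul_le_mul_of_nonneg_left hsq hPW.le]
  rw [div_le_div_iff₀ hDpos (by positivity), ← mul_assoc]
  exact mul_le_mul hle hdD hd0.le ((by positivity : 0 ≤ PW * ‖p‖).trans hle)
end
end

section
/- Let Ω ⊆ ℝ^n be a compact convex set and f : ℝ^n → ℝ differentiable with L-Lipschitz gradient (L > 0). Let μ > 0 and x* ∈ Ω be such that ‖π(T_Ω(x), −∇f(x))‖² ≥ 2μ(f(x) − f(x*)) and f(x) ≥ f(x*) for all x ∈ Ω. Let τ > 0, let x_k ∈ Ω, let d ≠ 0 satisfy the angle condition ⟨−∇f(x_k), d⟩ ≥ τ ‖π(T_Ω(x_k), −∇f(x_k))‖ · ‖d‖, and set x_{k+1} = x_k + ᾱ d with stepsize ᾱ = ⟨−∇f(x_k), d⟩/(L‖d‖²), assuming x_{k+1} ∈ Ω. Then f(x_{k+1}) − f(x*) ≤ (1 − (μ/L)τ²)(f(x_k) − f(x*)). -/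
open Set Metric RealInnerProductSpace

noncomputable section

/-- The descent lemma for functions with `L`-Lipschitz gradient. -/
theorem descent_of_lipschitz_gradient {E : Type*} [NormedAddCommGroup E] [InnerProductSpace ℝ E]
    [CompleteSpace E] {f : E → ℝ} {L : ℝ} (hdiff : ∀ x, DifferentiableAt ℝ f x)
    (hlip : ∀ x y, ‖gradient f x - gradient f y‖ ≤ L * ‖x - y‖) (x v : E) :
    f (x + v) ≤ f x + ⟪gradient f x, v⟫ + L / 2 * ‖v‖ ^ 2 := by
  let φ : ℝ → ℝ := fun t ↦ f (x + t • v) - t * ⟪gradient f x, v⟫ - L / 2 * ‖v‖ ^ 2 * t ^ 2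
  have hφ (t : ℝ) : HasDerivAt φ
      (⟪gradient f (x + t • v) - gradient f x, v⟫ - L * t * ‖v‖ ^ 2) t := by
    have hline : HasDerivAt (fun t : ℝ ↦ x + t • v) v t := by
      simpa using ((hasDerivAt_id t).smul_const v).const_add x
    have hf := (hdiff (x + t • v)).hasGradientAt.hasFDerivAt.comp_hasDerivAt t hline
    have hlin := (hasDerivAt_id t).mul_const ⟪gradient f x, v⟫
    have hquad := (hasDerivAt_pow 2 t).const_mul (L / 2 * ‖v‖ ^ 2)
    refine ((hf.sub hlin).sub hquad).congr_deriv ?_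
    simp only [InnerProductSpace.toDual_apply_apply, inner_sub_left]
    push_cast
    ring
  have hanti : AntitoneOn φ (Icc 0 1) := by
    refine antitoneOn_of_deriv_nonpos (convex_Icc 0 1)
      (fun t _ ↦ (hφ t).continuousAt.continuousWithinAt)
      (fun t _ ↦ (hφ t).differentiableAt.differentiableWithinAt) fun t ht ↦ ?_
    rw [interior_Icc] at ht
    rw [(hφ t).deriv, sub_nonpos]
    calc ⟪gradient f (x + t • v) - gradient f x, v⟫
        ≤ ‖gradient f (x + t • v) - gradient f x‖ * ‖v‖ := real_inner_le_norm _ _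
      _ ≤ L * ‖x + t • v - x‖ * ‖v‖ := by gcongr; exact hlip _ _
      _ = L * t * ‖v‖ ^ 2 := by
        rw [add_sub_cancel_left, norm_smul, Real.norm_of_nonneg ht.1.le]; ring
  have h := hanti (left_mem_Icc.2 zero_le_one) (right_mem_Icc.2 zero_le_one) zero_le_one
  simp only [φ, one_smul, zero_smul, add_zero] at h
  linarith

/-- Proposition 3, first part: under the KL inequality and the angle
condition, a step with the stepsize `ᾱ = ⟪-∇f(x_k), d⟫/(L‖d‖²)` contracts the
optimality gap by the factor `1 - (μ/L)τ²`. -/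
theorem stmt7 {n : ℕ} (Ω : Set (EuclideanSpace ℝ (Fin n)))
    (hΩcp : IsCompact Ω) (hΩconv : Convex ℝ Ω)
    (f : EuclideanSpace ℝ (Fin n) → ℝ) (L : ℝ) (hL : 0 < L)
    (hdiff : ∀ x, DifferentiableAt ℝ f x)
    (hlip : ∀ x y, ‖gradient f x - gradient f y‖ ≤ L * ‖x - y‖)
    (μ : ℝ) (hμ : 0 < μ)
    (xstar : EuclideanSpace ℝ (Fin n)) (hxstar : xstar ∈ Ω)
    (P : EuclideanSpace ℝ (Fin n) → EuclideanSpace ℝ (Fin n))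
    (hP : ∀ x ∈ Ω, IsProjection (tangentCone Ω x) (-gradient f x) (P x))
    (hKL : ∀ x ∈ Ω, 2 * μ * (f x - f xstar) ≤ ‖P x‖ ^ 2)
    (hlb : ∀ x ∈ Ω, f xstar ≤ f x)
    (τ : ℝ) (hτ : 0 < τ)
    (xk : EuclideanSpace ℝ (Fin n)) (hxk : xk ∈ Ω)
    (d : EuclideanSpace ℝ (Fin n)) (hd : d ≠ 0)
    (hangle : τ * (‖P xk‖ * ‖d‖) ≤ ⟪-gradient f xk, d⟫)
    (α : ℝ) (hα : α = ⟪-gradient f xk, d⟫ / (L * ‖d‖ ^ 2))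
    (hfeas : xk + α • d ∈ Ω) :
    f (xk + α • d) - f xstar ≤ (1 - μ / L * τ ^ 2) * (f xk - f xstar) := by
  have hdesc := descent_of_lipschitz_gradient hdiff hlip xk (α • d)
  have hd' : 0 < ‖d‖ := norm_pos_iff.2 hd
  set s := ⟪-gradient f xk, d⟫ with hs
  have hinner : ⟪gradient f xk, d⟫ = -s := by rw [hs, inner_neg_left, neg_neg]
  have hstep : ⟪gradient f xk, α • d⟫ + L / 2 * ‖α • d‖ ^ 2 = -(s ^ 2 / (2 * L * ‖d‖ ^ 2)) := by
    rw [real_inner_smul_right, hinner, norm_smul, mul_pow, Real.norm_eq_abs, sq_abs, hα]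
    field_simp
    ring
  have hsq : τ ^ 2 * (2 * μ * (f xk - f xstar)) * ‖d‖ ^ 2 ≤ s ^ 2 :=
    calc τ ^ 2 * (2 * μ * (f xk - f xstar)) * ‖d‖ ^ 2 ≤ τ ^ 2 * ‖P xk‖ ^ 2 * ‖d‖ ^ 2 := by
          gcongr; exact hKL xk hxk
      _ = (τ * (‖P xk‖ * ‖d‖)) ^ 2 := by ring
      _ ≤ s ^ 2 := by gcongr
  have hdecr : μ / L * τ ^ 2 * (f xk - f xstar) ≤ s ^ 2 / (2 * L * ‖d‖ ^ 2) := by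
    rw [le_div_iff₀ (by positivity)]
    refine le_of_eq_of_le ?_ hsq
    field_simp
  linarith
end
end
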